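/- arXiv:2102.12238 — 6 statements merged into one kernel-verified Lean document; each statement's English description precedes it below -/
import Mathlib

section
/- (Independence of the number of output channels.) For all integers 1 ≤ K ≤ D, every number of output channels C ≥ 1, and every w ∈ ℝ^D, the induced regularizer satisfies R_{K,C}(w) = R_{K,1}(w). -/
open scoped BigOperators

/-- Circular convolution of `u ∈ ℝ^K` with `v ∈ ℝ^D`:
`(u⋆v)[d] = (1/√D)·Σ_{k=0}^{K-1} u[k]·v[(d+k) mod D]`. -/
noncomputable def circConv {K D : ℕ} (u : Fin K → ℝ) (v : Fin D → ℝ) : Fin D → ℝ :=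
  fun d => (1 / Real.sqrt D) * ∑ k : Fin K, u k * v ⟨((d : ℕ) + (k : ℕ)) % D, Nat.mod_lt _ d.pos⟩

/-- Flip of a vector: `z↓[d] = z[D-1-d]`. -/
def flipVec {D : ℕ} (z : Fin D → ℝ) : Fin D → ℝ :=
  fun d => z ⟨D - 1 - (d : ℕ), by have := d.isLt; omega⟩

/-- Linear predictor realized by a two-layer linear convolutional network with
kernel size `K` and `C` output channels: `w(U,V) = Σ_c (U[:,c] ⋆ (V[:,c])↓)↓`. -/
noncomputable def predictor {K D C : ℕ} (U : Fin K → Fin C → ℝ) (V : Fin D → Fin C → ℝ) :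
    Fin D → ℝ :=
  fun d => ∑ c : Fin C, flipVec (circConv (fun k => U k c) (flipVec (fun l => V l c))) d

/-- The induced regularizer
`R_{K,C}(w) = inf { ‖U‖_F² + ‖V‖_F² : w(U,V) = w }`. -/
noncomputable def inducedReg (K D C : ℕ) (w : Fin D → ℝ) : ℝ :=
  sInf { t : ℝ | ∃ (U : Fin K → Fin C → ℝ) (V : Fin D → Fin C → ℝ),
    predictor U V = w ∧ t = (∑ k, ∑ c, (U k c) ^ 2) + ∑ l, ∑ c, (V l c) ^ 2 }

/-- Discrete Fourier transform: `ŵ[d] = (1/√D)·Σ_l w[l]·exp(-2πi·d·l/D)`. -/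
noncomputable def dft {D : ℕ} (w : Fin D → ℝ) : Fin D → ℂ :=
  fun d => (1 / (Real.sqrt D : ℂ)) * ∑ l : Fin D, (w l : ℂ) *
    Complex.exp (-((2 : ℂ) * (Real.pi : ℂ) * Complex.I * ((d : ℕ) : ℂ) * ((l : ℕ) : ℂ)) / (D : ℂ))

open Matrix in
/-- If two real matrices have the same Gram matrix of rows, then every vector in the range of the
first has a preimage under the second that is no longer than a given preimage under the first. -/
theorem exists_mulVec_eq_of_mul_transpose_eq {n m p : Type*} [Fintype n] [Fintype m] [Fintype p]
    (A : Matrix n m ℝ) (B : Matrix n p ℝ) (h : A * Aᵀ = B * Bᵀ) (x : m → ℝ) :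
    ∃ x' : p → ℝ, B *ᵥ x' = A *ᵥ x ∧ x' ⬝ᵥ x' ≤ x ⬝ᵥ x := by
  have hle : LinearMap.range (A * Aᵀ).mulVecLin ≤ LinearMap.range A.mulVecLin := by
    rw [Matrix.mulVecLin_mul]
    exact LinearMap.range_comp_le_range _ _
  have hrange : LinearMap.range (A * Aᵀ).mulVecLin = LinearMap.range A.mulVecLin :=
    Submodule.eq_of_le_of_finrank_eq hle (Matrix.rank_self_mul_transpose A)
  obtain ⟨y, hy⟩ : A *ᵥ x ∈ LinearMap.range (A * Aᵀ).mulVecLin := hrange ▸ ⟨x, rfl⟩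
  rw [Matrix.mulVecLin_apply] at hy
  have hBy : B *ᵥ (Bᵀ *ᵥ y) = A *ᵥ x := by rw [Matrix.mulVec_mulVec, ← h, hy]
  refine ⟨Bᵀ *ᵥ y, hBy, ?_⟩
  set z := Aᵀ *ᵥ y with hz
  have hBB : (Bᵀ *ᵥ y) ⬝ᵥ (Bᵀ *ᵥ y) = z ⬝ᵥ x := by
    rw [Matrix.dotProduct_mulVec, Matrix.vecMul_transpose, hBy, hz, dotProduct_comm,
      Matrix.dotProduct_mulVec, ← Matrix.mulVec_transpose]
  have hzz : z ⬝ᵥ z = z ⬝ᵥ x := by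
    have hAz : A *ᵥ z = A *ᵥ x := by rw [hz, Matrix.mulVec_mulVec, hy]
    have hadj : ∀ t, z ⬝ᵥ t = y ⬝ᵥ (A *ᵥ t) := fun t => by
      rw [hz, Matrix.mulVec_transpose, ← Matrix.dotProduct_mulVec]
    rw [hadj z, hAz, hadj x]
  have hnonneg : 0 ≤ (x - z) ⬝ᵥ (x - z) := Finset.sum_nonneg fun i _ => mul_self_nonneg _
  rw [sub_dotProduct, dotProduct_sub, dotProduct_sub, dotProduct_comm x z] at hnonneg
  linarith

/-- The Toeplitz quadratic form `Σ_{i,j} φ(i - j) a_i a_j` with symbol coefficients `φ`. -/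
def toeplitzForm {K : ℕ} (φ : ℤ → ℝ) (a : Fin K → ℝ) : ℝ :=
  ∑ i : Fin K, ∑ j : Fin K, φ ((i : ℤ) - (j : ℤ)) * (a i * a j)

theorem toeplitzForm_rotate {K : ℕ} (φ : ℤ → ℝ) (a b : Fin K → ℝ) {α β : ℝ}
    (h : α ^ 2 + β ^ 2 = 1) :
    toeplitzForm φ (fun i => α * a i + β * b i) + toeplitzForm φ (fun i => α * b i - β * a i) =
      toeplitzForm φ a + toeplitzForm φ b := by
  simp only [toeplitzForm, ← Finset.sum_add_distrib]
  refine Finset.sum_congr rfl fun i _ => Finset.sum_congr rfl fun j _ => ?_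
  linear_combination (φ ((i : ℤ) - (j : ℤ)) * (a i * a j + b i * b j)) * h

theorem toeplitzForm_shift {n : ℕ} (φ : ℤ → ℝ) (b : Fin (n + 1) → ℝ) (hb : b 0 = 0) :
    toeplitzForm φ (Fin.snoc (fun i : Fin n => b i.succ) 0 : Fin (n + 1) → ℝ) =
      toeplitzForm φ b := by
  have hcast : toeplitzForm φ (Fin.snoc (fun i : Fin n => b i.succ) 0 : Fin (n + 1) → ℝ) =
      ∑ i : Fin n, ∑ j : Fin n, φ ((i : ℤ) - (j : ℤ)) * (b i.succ * b j.succ) := by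
    simp [toeplitzForm, Fin.sum_univ_castSucc]
  rw [hcast]
  simp [toeplitzForm, Fin.sum_univ_succ (n := n), hb]

theorem sum_index_mul_sq_shift {n : ℕ} (b : Fin (n + 1) → ℝ) :
    ∑ i : Fin (n + 1), (i : ℝ) * (Fin.snoc (fun i : Fin n => b i.succ) 0 : Fin (n + 1) → ℝ) i ^ 2 +
      ∑ i : Fin n, b i.succ ^ 2 = ∑ i : Fin (n + 1), (i : ℝ) * b i ^ 2 := by
  rw [Fin.sum_univ_castSucc, Fin.sum_univ_succ (fun i : Fin (n + 1) => (i : ℝ) * b i ^ 2)]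
  simp [add_mul, Finset.sum_add_distrib]

theorem toeplitzForm_single_zero {K : ℕ} (a : Fin K → ℝ) :
    toeplitzForm (fun m => if m = 0 then 1 else 0) a = ∑ i, a i ^ 2 := by
  refine Finset.sum_congr rfl fun i _ => ?_
  simp [sub_eq_zero, Fin.val_inj, sq]

theorem continuous_toeplitzForm {K : ℕ} (φ : ℤ → ℝ) :
    Continuous (toeplitzForm φ : (Fin K → ℝ) → ℝ) := by
  unfold toeplitzForm
  fun_prop

theorem exists_rotation (s t : ℝ) : ∃ α β : ℝ, α ^ 2 + β ^ 2 = 1 ∧ α * t - β * s = 0 := by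
  by_cases h : s ^ 2 + t ^ 2 = 0
  · have hs : s = 0 := by nlinarith [sq_nonneg s, sq_nonneg t]
    have ht : t = 0 := by nlinarith [sq_nonneg s, sq_nonneg t]
    exact ⟨1, 0, by simp, by simp [hs, ht]⟩
  · have hpos : 0 < s ^ 2 + t ^ 2 := lt_of_le_of_ne (by positivity) (Ne.symm h)
    refine ⟨s / √(s ^ 2 + t ^ 2), t / √(s ^ 2 + t ^ 2), ?_, by ring⟩
    rw [div_pow, div_pow, Real.sq_sqrt hpos.le]
    field_simp

/-- A form of the Fejér–Riesz theorem: the autocorrelations of two real sequences of length `n + 1`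
add up to the autocorrelation of a single one. -/
theorem exists_toeplitzForm_eq_add {n : ℕ} (a b : Fin (n + 1) → ℝ) :
    ∃ p : Fin (n + 1) → ℝ, ∀ φ, toeplitzForm φ p = toeplitzForm φ a + toeplitzForm φ b := by
  set S : Set ((Fin (n + 1) → ℝ) × (Fin (n + 1) → ℝ)) :=
    {q | ∀ φ, toeplitzForm φ q.1 + toeplitzForm φ q.2 = toeplitzForm φ a + toeplitzForm φ b}
    with hS
  have hclosed : IsClosed S := by
    simp only [hS, Set.ofPred_forall]
    exact isClosed_iInter fun φ => isClosed_eq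
      (((continuous_toeplitzForm φ).comp continuous_fst).add
        ((continuous_toeplitzForm φ).comp continuous_snd)) continuous_const
  have hbdd : Bornology.IsBounded S := by
    set r := ∑ i, a i ^ 2 + ∑ i, b i ^ 2
    refine (Metric.isBounded_closedBall (x := 0) (r := √r)).subset fun q hq => ?_
    have hr := hq fun m => if m = 0 then 1 else 0
    simp only [toeplitzForm_single_zero] at hr
    have h₁ : ∀ i, q.1 i ^ 2 ≤ ∑ i, q.1 i ^ 2 := fun i =>
      Finset.single_le_sum (f := fun i => q.1 i ^ 2) (fun _ _ => sq_nonneg _) (Finset.mem_univ i)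
    have h₂ : ∀ i, q.2 i ^ 2 ≤ ∑ i, q.2 i ^ 2 := fun i =>
      Finset.single_le_sum (f := fun i => q.2 i ^ 2) (fun _ _ => sq_nonneg _) (Finset.mem_univ i)
    have h₃ : 0 ≤ ∑ i, q.1 i ^ 2 := Finset.sum_nonneg fun _ _ => sq_nonneg _
    have h₄ : 0 ≤ ∑ i, q.2 i ^ 2 := Finset.sum_nonneg fun _ _ => sq_nonneg _
    rw [mem_closedBall_zero_iff, Prod.norm_def, max_le_iff,
      pi_norm_le_iff_of_nonneg (Real.sqrt_nonneg _), pi_norm_le_iff_of_nonneg (Real.sqrt_nonneg _)]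
    exact ⟨fun i => Real.abs_le_sqrt (by linarith [h₁ i]),
      fun i => Real.abs_le_sqrt (by linarith [h₂ i])⟩
  -- A minimizer of the delay, which rotations preserve and a shift of one channel decreases.
  obtain ⟨⟨c, d⟩, hcd, hmin⟩ := (Metric.isCompact_of_isClosed_isBounded hclosed hbdd).exists_isMinOn
    ⟨(a, b), fun _ => rfl⟩
    (f := fun q => ∑ i : Fin (n + 1), (i : ℝ) * (q.1 i ^ 2 + q.2 i ^ 2))
    (by fun_prop)
  obtain ⟨α, β, hαβ, h0⟩ := exists_rotation (c 0) (d 0)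
  set c' : Fin (n + 1) → ℝ := fun i => α * c i + β * d i with hc'
  set d' : Fin (n + 1) → ℝ := fun i => α * d i - β * c i with hd'
  have hrot : ∀ φ, toeplitzForm φ c' + toeplitzForm φ d' = toeplitzForm φ a + toeplitzForm φ b :=
    fun φ => (toeplitzForm_rotate φ c d hαβ).trans (hcd φ)
  have hdelay : ∑ i : Fin (n + 1), (i : ℝ) * (c i ^ 2 + d i ^ 2) =
      ∑ i : Fin (n + 1), (i : ℝ) * (c' i ^ 2 + d' i ^ 2) := by
    refine Finset.sum_congr rfl fun i _ => ?_
    simp only [hc', hd']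
    linear_combination (-(i : ℝ) * (c i ^ 2 + d i ^ 2)) * hαβ
  have hshift := hmin (a := (c', (Fin.snoc (fun i : Fin n => d' i.succ) 0 : Fin (n + 1) → ℝ)))
    fun φ => by rw [toeplitzForm_shift φ d' h0, hrot φ]
  rw [Set.mem_ofPred_eq] at hshift
  beta_reduce at hshift
  rw [hdelay] at hshift
  simp only [mul_add, Finset.sum_add_distrib, add_le_add_iff_left] at hshift
  have hsum : ∑ i : Fin n, d' i.succ ^ 2 = 0 :=
    le_antisymm (by linarith [sum_index_mul_sq_shift d']) (Finset.sum_nonneg fun _ _ => sq_nonneg _)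
  have hzero : d' = 0 := by
    funext i
    refine Fin.cases h0 (fun j => ?_) i
    exact pow_eq_zero_iff two_ne_zero |>.1
      ((Finset.sum_eq_zero_iff_of_nonneg fun _ _ => sq_nonneg _).1 hsum j (Finset.mem_univ j))
  refine ⟨c', fun φ => ?_⟩
  rw [← hrot φ, hzero]
  simp [toeplitzForm]

theorem exists_toeplitzForm_eq_sum {n : ℕ} {ι : Type*} (s : Finset ι) (u : ι → Fin (n + 1) → ℝ) :
    ∃ p : Fin (n + 1) → ℝ, ∀ φ, toeplitzForm φ p = ∑ c ∈ s, toeplitzForm φ (u c) := by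
  classical
  induction s using Finset.induction_on with
  | empty => exact ⟨0, fun φ => by simp [toeplitzForm]⟩
  | insert c s hc ih =>
    obtain ⟨p, hp⟩ := ih
    obtain ⟨q, hq⟩ := exists_toeplitzForm_eq_add (u c) p
    exact ⟨q, fun φ => by rw [hq, hp, Finset.sum_insert hc]⟩

/-- The index `(d - k) mod D`, in the form produced by the two flips. -/
def convIndex {D : ℕ} (d : Fin D) (k : ℕ) : Fin D :=
  ⟨D - 1 - (D - 1 - (d : ℕ) + k) % D, by have := d.isLt; omega⟩

theorem convIndex_eq_iff {D : ℕ} (d e : Fin D) (k j : ℕ) :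
    convIndex d k = convIndex e j ↔ (D : ℤ) ∣ ((d : ℤ) - e) - ((k : ℤ) - j) := by
  have hd := d.isLt
  have he := e.isLt
  have h₁ := Nat.mod_lt (D - 1 - (d : ℕ) + k) d.pos
  have h₂ := Nat.mod_lt (D - 1 - (e : ℕ) + j) d.pos
  have hmod : convIndex d k = convIndex e j ↔
      D - 1 - (d : ℕ) + k ≡ D - 1 - (e : ℕ) + j [MOD D] := by
    simp only [convIndex, Fin.mk.injEq, Nat.ModEq]
    omega
  rw [hmod, Nat.modEq_iff_dvd]
  have hcast : ((D - 1 - (e : ℕ) + j : ℕ) : ℤ) - ((D - 1 - (d : ℕ) + k : ℕ) : ℤ) =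
      ((d : ℤ) - e) - ((k : ℤ) - j) := by omega
  rw [hcast]

/-- The matrix through which the second layer `V` enters the predictor. -/
noncomputable def predictorMatrix {K C : ℕ} (D : ℕ) (U : Fin K → Fin C → ℝ) :
    Matrix (Fin D) (Fin D × Fin C) ℝ :=
  fun d q => (1 / √D) * ∑ k : Fin K, if convIndex d k = q.1 then U k q.2 else 0

theorem predictor_eq_mulVec {K D C : ℕ} (U : Fin K → Fin C → ℝ) (V : Fin D → Fin C → ℝ) :
    predictor U V = (predictorMatrix D U).mulVec fun q => V q.1 q.2 := by
  funext d
  simp only [predictor, flipVec, circConv, Matrix.mulVec, dotProduct, predictorMatrix,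
    Fintype.sum_prod_type_right]
  refine Finset.sum_congr rfl fun c _ => ?_
  simp only [mul_assoc, ← Finset.mul_sum, Finset.sum_mul]
  rw [Finset.sum_comm]
  congr 1
  refine Finset.sum_congr rfl fun k _ => ?_
  rw [Finset.sum_eq_single (convIndex d k)]
  · simp [convIndex]
  · intro l _ hl
    simp [hl.symm]
  · simp

theorem predictorMatrix_mul_transpose_apply {K D C : ℕ} (U : Fin K → Fin C → ℝ) (d e : Fin D) :
    (predictorMatrix D U * (predictorMatrix D U).transpose) d e = (1 / √D) * (1 / √D) *
      ∑ c, toeplitzForm (fun m => if (D : ℤ) ∣ ((d : ℤ) - e) - m then 1 else 0)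
        (fun k => U k c) := by
  simp only [Matrix.mul_apply, Matrix.transpose_apply, predictorMatrix,
    Fintype.sum_prod_type_right, mul_mul_mul_comm, ← Finset.mul_sum]
  congr 1
  refine Finset.sum_congr rfl fun c _ => ?_
  simp only [Finset.sum_mul_sum, toeplitzForm, ← convIndex_eq_iff]
  rw [Finset.sum_comm]
  refine Finset.sum_congr rfl fun k _ => ?_
  rw [Finset.sum_comm]
  refine Finset.sum_congr rfl fun j _ => ?_
  simp [eq_comm]

theorem exists_single_channel_le {n D C : ℕ} (U : Fin (n + 1) → Fin C → ℝ)
    (V : Fin D → Fin C → ℝ) :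
    ∃ (U' : Fin (n + 1) → Fin 1 → ℝ) (V' : Fin D → Fin 1 → ℝ),
      predictor U' V' = predictor U V ∧
      (∑ k, ∑ c, (U' k c) ^ 2) + ∑ l, ∑ c, (V' l c) ^ 2 ≤
        (∑ k, ∑ c, (U k c) ^ 2) + ∑ l, ∑ c, (V l c) ^ 2 := by
  obtain ⟨p, hp⟩ := exists_toeplitzForm_eq_sum Finset.univ fun c k => U k c
  set U' : Fin (n + 1) → Fin 1 → ℝ := fun k _ => p k with hU'
  have hgram : predictorMatrix D U * (predictorMatrix D U).transpose =
      predictorMatrix D U' * (predictorMatrix D U').transpose := by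
    ext d e
    rw [predictorMatrix_mul_transpose_apply, predictorMatrix_mul_transpose_apply, ← hp]
    simp [hU']
  obtain ⟨x, hx, hle⟩ := exists_mulVec_eq_of_mul_transpose_eq _ _ hgram fun q => V q.1 q.2
  refine ⟨U', fun l c => x (l, c), ?_, add_le_add (le_of_eq ?_) ?_⟩
  · rw [predictor_eq_mulVec, predictor_eq_mulVec, ← hx]
  · have h := hp fun m => if m = 0 then 1 else 0
    simp only [toeplitzForm_single_zero] at h
    rw [Finset.sum_comm] at h
    simpa [hU'] using h
  · simpa only [dotProduct, Fintype.sum_prod_type, ← sq] using hle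

theorem exists_pad_channels {K D m : ℕ} (U : Fin K → Fin 1 → ℝ) (V : Fin D → Fin 1 → ℝ) :
    ∃ (U' : Fin K → Fin (m + 1) → ℝ) (V' : Fin D → Fin (m + 1) → ℝ),
      predictor U' V' = predictor U V ∧
      (∑ k, ∑ c, (U' k c) ^ 2) + ∑ l, ∑ c, (V' l c) ^ 2 =
        (∑ k, ∑ c, (U k c) ^ 2) + ∑ l, ∑ c, (V l c) ^ 2 := by
  refine ⟨fun k => Fin.cons (U k 0) 0, fun l => Fin.cons (V l 0) 0, ?_, ?_⟩
  · funext d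
    simp [predictor, flipVec, circConv, Fin.sum_univ_succ]
  · simp [Fin.sum_univ_succ]

/-- Independence of the number of output channels: `R_{K,C}(w) = R_{K,1}(w)`. -/
theorem induced_reg_channel_independent (K D C : ℕ) (hK : 1 ≤ K) (hKD : K ≤ D) (hC : 1 ≤ C)
    (w : Fin D → ℝ) :
    inducedReg K D C w = inducedReg K D 1 w := by
  obtain ⟨n, rfl⟩ : ∃ n, K = n + 1 := ⟨K - 1, by omega⟩
  obtain ⟨m, rfl⟩ : ∃ m, C = m + 1 := ⟨C - 1, by omega⟩
  have hbdd : ∀ C' : ℕ, BddBelow { t : ℝ | ∃ (U : Fin (n + 1) → Fin C' → ℝ)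
      (V : Fin D → Fin C' → ℝ),
      predictor U V = w ∧ t = (∑ k, ∑ c, (U k c) ^ 2) + ∑ l, ∑ c, (V l c) ^ 2 } := by
    rintro C'
    refine ⟨0, ?_⟩
    rintro t ⟨U, V, -, rfl⟩
    positivity
  have hsub : { t : ℝ | ∃ (U : Fin (n + 1) → Fin 1 → ℝ) (V : Fin D → Fin 1 → ℝ),
      predictor U V = w ∧ t = (∑ k, ∑ c, (U k c) ^ 2) + ∑ l, ∑ c, (V l c) ^ 2 } ⊆
      { t : ℝ | ∃ (U : Fin (n + 1) → Fin (m + 1) → ℝ) (V : Fin D → Fin (m + 1) → ℝ),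
      predictor U V = w ∧ t = (∑ k, ∑ c, (U k c) ^ 2) + ∑ l, ∑ c, (V l c) ^ 2 } := by
    rintro t ⟨U, V, rfl, rfl⟩
    obtain ⟨U', V', hpred, hnorm⟩ := exists_pad_channels (m := m) U V
    exact ⟨U', V', hpred, hnorm.symm⟩
  unfold inducedReg
  rcases Set.eq_empty_or_nonempty { t : ℝ | ∃ (U : Fin (n + 1) → Fin (m + 1) → ℝ)
      (V : Fin D → Fin (m + 1) → ℝ),
      predictor U V = w ∧ t = (∑ k, ∑ c, (U k c) ^ 2) + ∑ l, ∑ c, (V l c) ^ 2 } with he | hne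
  · rw [he, Set.subset_eq_empty hsub he]
  · have hle : ∀ t ∈ { t : ℝ | ∃ (U : Fin (n + 1) → Fin (m + 1) → ℝ)
        (V : Fin D → Fin (m + 1) → ℝ),
        predictor U V = w ∧ t = (∑ k, ∑ c, (U k c) ^ 2) + ∑ l, ∑ c, (V l c) ^ 2 },
        ∃ s ∈ { t : ℝ | ∃ (U : Fin (n + 1) → Fin 1 → ℝ) (V : Fin D → Fin 1 → ℝ),
        predictor U V = w ∧ t = (∑ k, ∑ c, (U k c) ^ 2) + ∑ l, ∑ c, (V l c) ^ 2 }, s ≤ t := by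
      rintro t ⟨U, V, rfl, rfl⟩
      obtain ⟨U', V', hpred, hnorm⟩ := exists_single_channel_le U V
      exact ⟨_, ⟨U', V', hpred, rfl⟩, hnorm⟩
    obtain ⟨t, ht⟩ := hne
    obtain ⟨s, hs, -⟩ := hle t ht
    refine le_antisymm (csInf_le_csInf (hbdd _) ⟨s, hs⟩ hsub) (le_csInf ⟨t, ht⟩ fun t ht => ?_)
    obtain ⟨s, hs, hst⟩ := hle t ht
    exact (csInf_le (hbdd 1) hs).trans hst
end

section
/- (Necessity of multiple output channels for multi-channel inputs.) Let 1 ≤ K ≤ D and C, R ≥ 1. If every matrix W ∈ ℝ^{D×R} is realizable, i.e., for every W ∈ ℝ^{D×R} there exist weights U_r ∈ ℝ^{K×C} (r = 0,...,R-1) and V ∈ ℝ^{D×C} with W(𝒰,V) = W, then K·C ≥ min{R, D}. -/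
open scoped BigOperators

/-- Matrix-valued linear predictor of the multi-input-channel two-layer linear
convolutional network: column `r` is `Σ_c (U_r[:,c] ⋆ (V[:,c])↓)↓`. -/
noncomputable def mPredictor {K D C R : ℕ} (U : Fin R → Fin K → Fin C → ℝ)
    (V : Fin D → Fin C → ℝ) : Matrix (Fin D) (Fin R) ℝ :=
  Matrix.of fun d r =>
    ∑ c : Fin C, flipVec (circConv (fun k => U r k c) (flipVec (fun l => V l c))) d

open Matrix in
/-- The multi-channel linear predictor factors through `ℝ^{K·C}`: its columns lie in the span of
the `K·C` circular shifts of the columns of `V`. -/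
theorem mPredictor_eq_mul {K D C R : ℕ} (U : Fin R → Fin K → Fin C → ℝ) (V : Fin D → Fin C → ℝ) :
    mPredictor U V =
      (of fun (d : Fin D) (p : Fin C × Fin K) => (1 / Real.sqrt D) *
        flipVec (fun e : Fin D => flipVec (fun l => V l p.1)
          ⟨((e : ℕ) + (p.2 : ℕ)) % D, Nat.mod_lt _ e.pos⟩) d) *
      of fun (p : Fin C × Fin K) (r : Fin R) => U r p.2 p.1 := by
  ext d r
  simp only [mPredictor, circConv, flipVec, of_apply, mul_apply, Fintype.sum_prod_type,
    Finset.mul_sum]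
  exact Finset.sum_congr rfl fun c _ => Finset.sum_congr rfl fun k _ => by ring

theorem rank_mPredictor_le {K D C R : ℕ} (U : Fin R → Fin K → Fin C → ℝ)
    (V : Fin D → Fin C → ℝ) : (mPredictor U V).rank ≤ K * C := by
  rw [mPredictor_eq_mul]
  refine (Matrix.rank_mul_le_left _ _).trans ((Matrix.rank_le_card_width _).trans_eq ?_)
  simp [mul_comm]

/-- There are rectangular matrices of full rank. -/
theorem exists_min_le_rank (D R : ℕ) : ∃ W : Matrix (Fin D) (Fin R) ℝ, min R D ≤ W.rank := by
  refine ⟨Matrix.of fun d r => if (d : ℕ) = r then 1 else 0, ?_⟩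
  set W : Matrix (Fin D) (Fin R) ℝ := Matrix.of fun d r => if (d : ℕ) = r then 1 else 0 with hW
  have h : W.submatrix (Fin.castLE (min_le_right R D)) (Fin.castLE (min_le_left R D)) = 1 := by
    ext i j
    simp [hW, Matrix.one_apply, Fin.ext_iff]
  calc min R D = (1 : Matrix (Fin (min R D)) (Fin (min R D)) ℝ).rank := by simp [Matrix.rank_one]
    _ ≤ W.rank := by
      rw [← h]
      exact Matrix.rank_submatrix_le _ _ _

/-- Necessity of multiple output channels for multi-channel inputs: if every matrix in
`ℝ^{D×R}` is realizable, then `K·C ≥ min{R, D}`. -/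
theorem realizability_needs_channels (K D C R : ℕ) (hK : 1 ≤ K) (hKD : K ≤ D)
    (hC : 1 ≤ C) (hR : 1 ≤ R)
    (hreal : ∀ W : Matrix (Fin D) (Fin R) ℝ,
      ∃ (U : Fin R → Fin K → Fin C → ℝ) (V : Fin D → Fin C → ℝ), mPredictor U V = W) :
    min R D ≤ K * C := by
  obtain ⟨W, hW⟩ := exists_min_le_rank D R
  obtain ⟨U, V, rfl⟩ := hreal W
  exact hW.trans (rank_mPredictor_le U V)
end

section
/- (Rank bound for multi-channel linear convolutional networks.) For all integers 1 ≤ K ≤ D and C, R ≥ 1 and all weights U_r ∈ ℝ^{K×C} (r = 0,...,R-1) and V ∈ ℝ^{D×C}, the realized matrix satisfies rank(W(𝒰,V)) ≤ K·C. -/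
open scoped BigOperators

/-- The matrix of flipped cyclic shifts of the columns of `V`, scaled by `1/√D`; its columns are
indexed by a kernel position and a channel. -/
noncomputable def shiftMatrix {D C : ℕ} (K : ℕ) (V : Fin D → Fin C → ℝ) :
    Matrix (Fin D) (Fin K × Fin C) ℝ :=
  Matrix.of fun d p => flipVec (fun e => (1 / Real.sqrt D) *
    flipVec (fun l => V l p.2) ⟨((e : ℕ) + (p.1 : ℕ)) % D, Nat.mod_lt _ e.pos⟩) d

theorem mPredictor_eq_shiftMatrix_mul {K D C R : ℕ} (U : Fin R → Fin K → Fin C → ℝ)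
    (V : Fin D → Fin C → ℝ) :
    mPredictor U V =
      shiftMatrix K V * (Matrix.of fun (p : Fin K × Fin C) (r : Fin R) => U r p.1 p.2) := by
  ext d r
  simp only [mPredictor, shiftMatrix, Matrix.mul_apply, Matrix.of_apply,
    Fintype.sum_prod_type_right, flipVec, circConv, Finset.mul_sum]
  refine Finset.sum_congr rfl fun c _ => Finset.sum_congr rfl fun k _ => ?_
  ring

/-- Rank bound: `rank(W(𝒰,V)) ≤ K·C`. -/
theorem mPredictor_rank_le (K D C R : ℕ) (hK : 1 ≤ K) (hKD : K ≤ D) (hC : 1 ≤ C) (hR : 1 ≤ R)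
    (U : Fin R → Fin K → Fin C → ℝ) (V : Fin D → Fin C → ℝ) :
    (mPredictor U V).rank ≤ K * C := by
  rw [mPredictor_eq_shiftMatrix_mul]
  calc _ ≤ (shiftMatrix K V).rank := Matrix.rank_mul_le_left _ _
    _ ≤ Fintype.card (Fin K × Fin C) := Matrix.rank_le_card_width _
    _ = K * C := by simp
end

section
/- (Sufficiency of C ≥ min{R,D} output channels.) Let 1 ≤ K ≤ D and R ≥ 1, and suppose C ≥ min{R, D}. Then for every matrix W ∈ ℝ^{D×R} there exist weights U_r ∈ ℝ^{K×C} (r = 0,...,R-1) and V ∈ ℝ^{D×C} such that W(𝒰,V) = W. -/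
open scoped BigOperators

theorem Matrix.exists_eq_mul_of_embedding {m n p α : Type*} [Fintype p] [DecidableEq p]
    [NonAssocSemiring α] (e : n ↪ p) (W : Matrix m n α) :
    ∃ (A : Matrix m p α) (B : Matrix p n α), W = A * B := by
  refine ⟨Matrix.of fun i => Function.extend e (W i) 0, (1 : Matrix p p α).submatrix id e, ?_⟩
  ext i j
  simp [Matrix.mul_apply, Matrix.one_apply, e.injective.extend_apply]

theorem Matrix.exists_eq_mul_of_min_le {D C R : ℕ} (hC : min R D ≤ C)
    (W : Matrix (Fin D) (Fin R) ℝ) :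
    ∃ (A : Matrix (Fin D) (Fin C) ℝ) (B : Matrix (Fin C) (Fin R) ℝ), W = A * B := by
  rcases min_le_iff.mp hC with h | h
  · exact W.exists_eq_mul_of_embedding (Fin.castLEEmb h)
  · obtain ⟨A, B, hAB⟩ := W.transpose.exists_eq_mul_of_embedding (Fin.castLEEmb h)
    exact ⟨B.transpose, A.transpose, by
      rw [← Matrix.transpose_mul, ← hAB, Matrix.transpose_transpose]⟩

/-- A kernel supported at its first entry acts by scaling. -/
theorem flipVec_circConv_single {K D : ℕ} (hK : 0 < K) (a : ℝ) (v : Fin D → ℝ) (d : Fin D) :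
    flipVec (circConv (Pi.single (⟨0, hK⟩ : Fin K) a) (flipVec v)) d =
      1 / Real.sqrt D * (a * v d) := by
  have hd := d.isLt
  have hidx : D - 1 - (D - 1 - (d : ℕ)) % D = d := by
    rw [Nat.mod_eq_of_lt (by omega)]
    omega
  simp only [flipVec, circConv]
  rw [Finset.sum_eq_single (⟨0, hK⟩ : Fin K) (fun k _ hk => by simp [hk]) (by simp)]
  simp [hidx]

/-- Sufficiency of `C ≥ min{R, D}` output channels: every `W ∈ ℝ^{D×R}` is realizable. -/
theorem realizable_of_enough_channels (K D C R : ℕ) (hK : 1 ≤ K) (hKD : K ≤ D) (hR : 1 ≤ R)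
    (hC : min R D ≤ C) (W : Matrix (Fin D) (Fin R) ℝ) :
    ∃ (U : Fin R → Fin K → Fin C → ℝ) (V : Fin D → Fin C → ℝ), mPredictor U V = W := by
  obtain ⟨A, B, hAB⟩ := Matrix.exists_eq_mul_of_min_le hC W
  have hD : Real.sqrt D ≠ 0 := (Real.sqrt_pos.mpr (by exact_mod_cast hK.trans hKD)).ne'
  refine ⟨fun r k c => (Pi.single (⟨0, hK⟩ : Fin K) (Real.sqrt D * B c r) : Fin K → ℝ) k, A, ?_⟩
  ext d r
  simp only [mPredictor, Matrix.of_apply, flipVec_circConv_single, hAB, Matrix.mul_apply]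
  refine Finset.sum_congr rfl fun c _ => ?_
  field_simp
end

section
/- (Sum of two self-convolutions is a self-convolution, special case D = 2K−1.) For every integer K ≥ 1, with base dimension D = 2K−1, and for all vectors a, b ∈ ℝ^K, there exists a vector c ∈ ℝ^K such that a⋆a + b⋆b = c⋆c in ℝ^D, where for x ∈ ℝ^K, x⋆x denotes the circular convolution of x with the zero-padding of x to ℝ^D. -/
open scoped BigOperators

/-- Zero-padding of `x ∈ ℝ^K` to `ℝ^D`. -/
def pad (D : ℕ) {K : ℕ} (x : Fin K → ℝ) : Fin D → ℝ :=
  fun d => if h : (d : ℕ) < K then x ⟨(d : ℕ), h⟩ else 0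

theorem pad_linear_comb {K : ℕ} (D : ℕ) (c s : ℝ) (x y : Fin K → ℝ) (j : Fin D) :
    pad D (fun k => c * x k + s * y k) j = c * pad D x j + s * pad D y j := by
  unfold pad
  split_ifs <;> simp

theorem continuous_pad {K D : ℕ} : Continuous (fun x : Fin K → ℝ => pad D x) := by
  refine continuous_pi fun j => ?_
  unfold pad
  split_ifs <;> fun_prop

theorem continuous_selfConv {K D : ℕ} :
    Continuous (fun x : Fin K → ℝ => circConv x (pad D x)) := by
  have h := continuous_pad (K := K) (D := D)
  unfold circConv
  fun_prop

/-- Self-convolution as the cyclic autocorrelation of the padded vector. -/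
theorem selfConv_apply {K D : ℕ} [NeZero D] (hKD : K ≤ D) (x : Fin K → ℝ) (d : Fin D) :
    circConv x (pad D x) d =
      (1 / Real.sqrt D) * ∑ j : Fin D, pad D x j * pad D x (d + j) := by
  unfold circConv
  congr 1
  refine Fintype.sum_of_injective (Fin.castLE hKD) (Fin.castLE_injective hKD) _ _ ?_ ?_
  · intro j hj
    have hjK : ¬ (j : ℕ) < K := fun h => hj ⟨⟨j, h⟩, rfl⟩
    simp [pad, hjK]
  · intro k
    have hk : pad D x (Fin.castLE hKD k) = x k := by simp [pad]
    rw [hk]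
    rfl

theorem selfConv_zero_lag {K D : ℕ} [NeZero D] (hKD : K ≤ D) (x : Fin K → ℝ) :
    circConv x (pad D x) 0 = (1 / Real.sqrt D) * ∑ k, x k ^ 2 := by
  unfold circConv
  congr 1
  refine Finset.sum_congr rfl fun k _ => ?_
  have hk : (k : ℕ) % D = k := Nat.mod_eq_of_lt (k.isLt.trans_le hKD)
  simp [pad, hk, sq]

theorem selfConv_zero {K D : ℕ} : circConv (0 : Fin K → ℝ) (pad D (0 : Fin K → ℝ)) = 0 := by
  ext d
  simp [circConv]

/-- Rotating a pair of vectors preserves the sum of their self-convolutions. -/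
theorem selfConv_rotate {K D : ℕ} [NeZero D] (hKD : K ≤ D) (x y : Fin K → ℝ) {c s : ℝ}
    (hcs : c ^ 2 + s ^ 2 = 1) :
    circConv (fun k => c * x k + s * y k) (pad D fun k => c * x k + s * y k) +
      circConv (fun k => -s * x k + c * y k) (pad D fun k => -s * x k + c * y k) =
    circConv x (pad D x) + circConv y (pad D y) := by
  ext d
  simp only [Pi.add_apply, selfConv_apply hKD, pad_linear_comb, ← mul_add,
    ← Finset.sum_add_distrib]
  congr 1
  refine Finset.sum_congr rfl fun j _ => ?_
  linear_combination
    (pad D x j * pad D x (d + j) + pad D y j * pad D y (d + j)) * hcs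

/-- Left shift by `m`, filling with zeros. -/
def shiftLeft {K : ℕ} (m : ℕ) (x : Fin K → ℝ) : Fin K → ℝ :=
  fun k => if h : (k : ℕ) + m < K then x ⟨k + m, h⟩ else 0

theorem pad_shiftLeft {K D : ℕ} [NeZero D] (hKD : K ≤ D) (x : Fin K → ℝ) (m : Fin K)
    (hx : ∀ k < m, x k = 0) (j : Fin D) :
    pad D (shiftLeft m x) j = pad D x (j + Fin.castLE hKD m) := by
  have hj := j.isLt
  have hm := m.isLt
  unfold pad shiftLeft
  simp only [Fin.val_add, Fin.val_castLE]
  by_cases hD : (j : ℕ) + m < D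
  · simp only [Nat.mod_eq_of_lt hD]
    split_ifs <;> first | rfl | omega
  · have hmod : ((j : ℕ) + m) % D = j + m - D := by
      rw [Nat.mod_eq_sub_mod (by omega), Nat.mod_eq_of_lt (by omega)]
    simp only [hmod]
    rw [dif_pos (show (j : ℕ) + m - D < K by omega),
      hx _ (by rw [Fin.lt_def]; simp only; omega)]
    split_ifs <;> first | rfl | omega

/-- Shifting out leading zeros preserves the self-convolution. -/
theorem selfConv_shiftLeft {K D : ℕ} [NeZero D] (hKD : K ≤ D) (x : Fin K → ℝ) (m : Fin K)
    (hx : ∀ k < m, x k = 0) :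
    circConv (shiftLeft m x) (pad D (shiftLeft m x)) = circConv x (pad D x) := by
  ext d
  simp only [selfConv_apply hKD, pad_shiftLeft hKD x m hx, add_assoc]
  congr 1
  exact Equiv.sum_comp (Equiv.addRight (Fin.castLE hKD m))
    fun j => pad D x j * pad D x (d + j)

/-- A nonzero vector has the same self-convolution as one with nonzero leading entry. -/
theorem exists_selfConv_eq_leading_ne_zero {K D : ℕ} [NeZero K] [NeZero D] (hKD : K ≤ D)
    {x : Fin K → ℝ} (hx : x ≠ 0) :
    ∃ y : Fin K → ℝ, circConv y (pad D y) = circConv x (pad D x) ∧ y 0 ≠ 0 := by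
  obtain ⟨k, hk⟩ := Function.ne_iff.mp hx
  obtain ⟨m, hm, hmin⟩ := WellFounded.has_min (wellFounded_lt (α := Fin K))
    {k | x k ≠ 0} ⟨k, hk⟩
  refine ⟨shiftLeft m x, selfConv_shiftLeft hKD x m fun i hi => ?_, ?_⟩
  · by_contra h
    exact hmin i h hi
  · simpa [shiftLeft] using hm

theorem isCompact_selfConv_add_eq {K D : ℕ} [NeZero D] (hKD : K ≤ D) (w : Fin D → ℝ) :
    IsCompact {p : (Fin K → ℝ) × (Fin K → ℝ) |
      circConv p.1 (pad D p.1) + circConv p.2 (pad D p.2) = w} := by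
  have hcont := continuous_selfConv (K := K) (D := D)
  refine Metric.isCompact_of_isClosed_isBounded
    (isClosed_eq ((hcont.comp continuous_fst).add (hcont.comp continuous_snd))
      continuous_const) ?_
  refine (Metric.isBounded_closedBall (x := 0) (r := Real.sqrt D * w 0 + 1)).subset ?_
  rintro ⟨x, y⟩ h
  have hD : 0 < Real.sqrt D := Real.sqrt_pos.mpr (by exact_mod_cast NeZero.pos D)
  have hsum : ∑ k, x k ^ 2 + ∑ k, y k ^ 2 = Real.sqrt D * w 0 := by
    have h0 := congrFun h 0
    simp only [Pi.add_apply, selfConv_zero_lag hKD] at h0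
    rw [← h0]
    field_simp
  have hnn : ∀ z : Fin K → ℝ, 0 ≤ ∑ k, z k ^ 2 :=
    fun z => Finset.sum_nonneg fun k _ => sq_nonneg _
  have hb : ∀ z : Fin K → ℝ, ‖z‖ ≤ ∑ k, z k ^ 2 + 1 := by
    intro z
    refine (pi_norm_le_iff_of_nonneg (by linarith [hnn z])).mpr fun k => ?_
    have hk : z k ^ 2 ≤ ∑ k, z k ^ 2 :=
      Finset.single_le_sum (f := fun k => z k ^ 2) (fun i _ => sq_nonneg _) (Finset.mem_univ k)
    rw [Real.norm_eq_abs]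
    nlinarith [sq_abs (z k), sq_nonneg (|z k| - 1)]
  rw [mem_closedBall_zero_iff, Prod.norm_def, max_le_iff]
  constructor
  · linarith [hb x, hnn y]
  · linarith [hb y, hnn x]

/-- A pair maximizing the energy of the leading entries among all pairs with the same sum of
self-convolutions can be rotated so that its second vector vanishes. -/
theorem exists_selfConv_eq_add {K D : ℕ} [NeZero K] [NeZero D] (hKD : K ≤ D)
    (a b : Fin K → ℝ) :
    ∃ c : Fin K → ℝ,
      circConv a (pad D a) + circConv b (pad D b) = circConv c (pad D c) := by
  obtain ⟨⟨x, y⟩, hxy, hmax⟩ := (isCompact_selfConv_add_eq hKD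
    (circConv a (pad D a) + circConv b (pad D b))).exists_isMaxOn ⟨(a, b), rfl⟩
    (f := fun p => p.1 0 ^ 2 + p.2 0 ^ 2) (by fun_prop)
  simp only [Set.mem_ofPred_eq] at hxy
  obtain ⟨c, s, hcs, hy0⟩ : ∃ c s : ℝ, c ^ 2 + s ^ 2 = 1 ∧ -s * x 0 + c * y 0 = 0 := by
    by_cases h : x 0 ^ 2 + y 0 ^ 2 = 0
    · exact ⟨1, 0, by norm_num, by nlinarith [sq_nonneg (x 0), sq_nonneg (y 0)]⟩
    · have hpos : 0 < x 0 ^ 2 + y 0 ^ 2 := lt_of_le_of_ne (by positivity) (Ne.symm h)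
      refine ⟨x 0 / √(x 0 ^ 2 + y 0 ^ 2), y 0 / √(x 0 ^ 2 + y 0 ^ 2), ?_, by ring⟩
      rw [div_pow, div_pow, Real.sq_sqrt hpos.le, ← add_div, div_self h]
  have hrot := (selfConv_rotate hKD x y hcs).trans hxy
  set u : Fin K → ℝ := fun k => c * x k + s * y k with hu
  set v : Fin K → ℝ := fun k => -s * x k + c * y k
  have hu0 : u 0 ^ 2 = x 0 ^ 2 + y 0 ^ 2 := by
    simp only [hu]
    linear_combination (x 0 ^ 2 + y 0 ^ 2) * hcs - (-s * x 0 + c * y 0) * hy0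
  by_cases hv : v = 0
  · refine ⟨u, ?_⟩
    rw [← hrot, hv, selfConv_zero, add_zero]
  · obtain ⟨z, hz, hz0⟩ := exists_selfConv_eq_leading_ne_zero hKD hv
    rw [← hz] at hrot
    have hle : u 0 ^ 2 + z 0 ^ 2 ≤ x 0 ^ 2 + y 0 ^ 2 := hmax (a := (u, z)) hrot
    have := pow_pos (abs_pos.mpr hz0) 2
    rw [sq_abs] at this
    linarith

/-- Sum of two self-convolutions is a self-convolution, special case `D = 2K−1`:
for all `a, b ∈ ℝ^K` there is `c ∈ ℝ^K` with `a⋆a + b⋆b = c⋆c` in `ℝ^{2K-1}`. -/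
theorem selfConv_add_selfConv_special (K : ℕ) (hK : 1 ≤ K) (a b : Fin K → ℝ) :
    ∃ c : Fin K → ℝ,
      circConv a (pad (2 * K - 1) a) + circConv b (pad (2 * K - 1) b) =
        circConv c (pad (2 * K - 1) c) := by
  have : NeZero K := ⟨by omega⟩
  have : NeZero (2 * K - 1) := ⟨by omega⟩
  exact exists_selfConv_eq_add (by omega) a b
end

section
/- (Sum of two self-convolutions is a self-convolution.) For all integers K ≥ 1 and D ≥ K, and for all vectors a, b ∈ ℝ^K, there exists a vector c ∈ ℝ^K such that a⋆a + b⋆b = c⋆c in ℝ^D, where for x ∈ ℝ^K, x⋆x denotes the circular convolution of x with the zero-padding of x to ℝ^D. -/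
open scoped BigOperators

/-- Shift one step towards index `0`, dropping the first entry and appending a zero. -/
def shiftVec {n : ℕ} (y : Fin (n + 1) → ℝ) : Fin (n + 1) → ℝ :=
  fun k => if h : (k : ℕ) + 1 < n + 1 then y ⟨(k : ℕ) + 1, h⟩ else 0

theorem pad_shiftVec {n D : ℕ} (hD : n + 1 ≤ D) {y : Fin (n + 1) → ℝ} (hy : y 0 = 0) (m : Fin D) :
    pad D (shiftVec y) m = pad D y ⟨((m : ℕ) + 1) % D, Nat.mod_lt _ m.pos⟩ := by
  have hm := m.isLt
  rcases Nat.lt_or_ge ((m : ℕ) + 1) D with h | h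
  · simp only [pad, shiftVec, Nat.mod_eq_of_lt h]
    split_ifs <;> first | rfl | omega
  · have hmD : (m : ℕ) + 1 = D := by omega
    have hy' : y ⟨0, n.succ_pos⟩ = 0 := hy
    simp only [pad, shiftVec, hmD, Nat.mod_self]
    split_ifs <;> first | exact hy'.symm | omega

theorem circConv_pad_shiftVec {n D : ℕ} (hD : n + 1 ≤ D) {y : Fin (n + 1) → ℝ} (hy : y 0 = 0) :
    circConv (shiftVec y) (pad D (shiftVec y)) = circConv y (pad D y) := by
  ext d
  simp only [circConv, pad_shiftVec hD hy]
  congr 1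
  rw [Fin.sum_univ_castSucc, Fin.sum_univ_succ, hy]
  simp [shiftVec, add_assoc, Fin.succ]

theorem circConv_pad_rotate {K D : ℕ} (x y : Fin K → ℝ) {s t : ℝ} (h : s ^ 2 + t ^ 2 = 1) :
    circConv (s • x + t • y) (pad D (s • x + t • y)) +
        circConv (s • y - t • x) (pad D (s • y - t • x)) =
      circConv x (pad D x) + circConv y (pad D y) := by
  have hadd (m : Fin D) : pad D (s • x + t • y) m = s * pad D x m + t * pad D y m := by
    simp only [pad]
    split_ifs <;> simp
  have hsub (m : Fin D) : pad D (s • y - t • x) m = s * pad D y m - t * pad D x m := by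
    simp only [pad]
    split_ifs <;> simp
  ext d
  simp only [circConv, Pi.add_apply, hadd, hsub, ← mul_add, ← Finset.sum_add_distrib]
  congr 1
  refine Finset.sum_congr rfl fun k _ => ?_
  simp only [Pi.sub_apply, Pi.smul_apply, smul_eq_mul]
  linear_combination (x k * pad D x _ + y k * pad D y _) * h

theorem circConv_pad_zero_index {K D : ℕ} (hD : 0 < D) (hKD : K ≤ D) (x : Fin K → ℝ) :
    circConv x (pad D x) ⟨0, hD⟩ = (1 / Real.sqrt D) * ∑ k, x k ^ 2 := by
  simp only [circConv]
  congr 1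
  refine Finset.sum_congr rfl fun k _ => ?_
  have hk : (k : ℕ) < D := k.isLt.trans_le hKD
  simp [pad, Nat.mod_eq_of_lt hk, sq]

theorem continuous_circConv_pad {K D : ℕ} :
    Continuous fun x : Fin K → ℝ => circConv x (pad D x) := by
  refine continuous_pi fun d => ?_
  simp only [circConv, pad]
  refine continuous_const.mul (continuous_finsetSum _ fun k _ => (continuous_apply k).mul ?_)
  split_ifs
  · exact continuous_apply _
  · exact continuous_const

theorem isCompact_setOf_circConv_pad_add {K D : ℕ} (hD : 0 < D) (hKD : K ≤ D) (r : Fin D → ℝ) :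
    IsCompact {p : (Fin K → ℝ) × (Fin K → ℝ) |
      circConv p.1 (pad D p.1) + circConv p.2 (pad D p.2) = r} := by
  have hclosed : IsClosed {p : (Fin K → ℝ) × (Fin K → ℝ) |
      circConv p.1 (pad D p.1) + circConv p.2 (pad D p.2) = r} :=
    isClosed_eq ((continuous_circConv_pad.comp continuous_fst).add
      (continuous_circConv_pad.comp continuous_snd)) continuous_const
  set R := Real.sqrt (Real.sqrt D * r ⟨0, hD⟩)
  refine (isCompact_closedBall (0 : (Fin K → ℝ) × (Fin K → ℝ)) R).of_isClosed_subset hclosed ?_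
  rintro ⟨x, y⟩ hxy
  have hsqrt : Real.sqrt D ≠ 0 := by positivity
  have hsum : ∑ k, x k ^ 2 + ∑ k, y k ^ 2 = Real.sqrt D * r ⟨0, hD⟩ := by
    have h : circConv x (pad D x) + circConv y (pad D y) = r := hxy
    rw [← h, Pi.add_apply, circConv_pad_zero_index hD hKD, circConv_pad_zero_index hD hKD]
    field_simp
  have hx0 : 0 ≤ ∑ k, x k ^ 2 := Finset.sum_nonneg fun k _ => sq_nonneg _
  have hy0 : 0 ≤ ∑ k, y k ^ 2 := Finset.sum_nonneg fun k _ => sq_nonneg _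
  rw [mem_closedBall_zero_iff, Prod.norm_def, max_le_iff, pi_norm_le_iff_of_nonneg
    (Real.sqrt_nonneg _), pi_norm_le_iff_of_nonneg (Real.sqrt_nonneg _)]
  refine ⟨fun k => Real.abs_le_sqrt ?_, fun k => Real.abs_le_sqrt ?_⟩
  · have := Finset.single_le_sum (f := fun k => x k ^ 2) (fun k _ => sq_nonneg _)
      (Finset.mem_univ k)
    linarith
  · have := Finset.single_le_sum (f := fun k => y k ^ 2) (fun k _ => sq_nonneg _)
      (Finset.mem_univ k)
    linarith

/-- If no pair with the same sum of self-convolutions has a larger first entry in its first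
component, then the second component vanishes. -/
theorem eq_zero_of_circConv_pad_add_maximal {n D : ℕ} (hD : n + 1 ≤ D) {r : Fin D → ℝ}
    {x : Fin (n + 1) → ℝ}
    (hmax : ∀ u v : Fin (n + 1) → ℝ,
      circConv u (pad D u) + circConv v (pad D v) = r → u 0 ≤ x 0)
    {y : Fin (n + 1) → ℝ} (hxy : circConv x (pad D x) + circConv y (pad D y) = r) : y = 0 := by
  have hfirst {v : Fin (n + 1) → ℝ} (hv : circConv x (pad D x) + circConv v (pad D v) = r) :
      v 0 = 0 := by
    by_contra hne
    have hpos : 0 < x 0 ^ 2 + v 0 ^ 2 := by positivity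
    set ρ := Real.sqrt (x 0 ^ 2 + v 0 ^ 2)
    have hρ : 0 < ρ := Real.sqrt_pos.2 hpos
    have hρ2 : ρ ^ 2 = x 0 ^ 2 + v 0 ^ 2 := Real.sq_sqrt hpos.le
    have hst : (x 0 / ρ) ^ 2 + (v 0 / ρ) ^ 2 = 1 := by
      field_simp
      exact hρ2.symm
    have hle := hmax _ _ ((circConv_pad_rotate x v hst).trans hv)
    have hval : ((x 0 / ρ) • x + (v 0 / ρ) • v) 0 = ρ := by
      simp only [Pi.add_apply, Pi.smul_apply, smul_eq_mul]
      field_simp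
      exact hρ2.symm
    rw [hval] at hle
    have : 0 < v 0 ^ 2 := by positivity
    nlinarith
  have hall (j : ℕ) : ∀ v : Fin (n + 1) → ℝ, circConv x (pad D x) + circConv v (pad D v) = r →
      ∀ hj : j < n + 1, v ⟨j, hj⟩ = 0 := by
    induction j with
    | zero => exact fun v hv _ => hfirst hv
    | succ j ih =>
      intro v hv hj
      have := ih (shiftVec v) (by rwa [circConv_pad_shiftVec hD (hfirst hv)]) (by omega)
      simpa only [shiftVec, hj, dite_true] using this
  exact funext fun k => hall k y hxy k.isLt

/-- Sum of two self-convolutions is a self-convolution: for all `K ≥ 1`, `D ≥ K`, and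
`a, b ∈ ℝ^K` there is `c ∈ ℝ^K` with `a⋆a + b⋆b = c⋆c` in `ℝ^D`. -/
theorem selfConv_add_selfConv (K D : ℕ) (hK : 1 ≤ K) (hKD : K ≤ D) (a b : Fin K → ℝ) :
    ∃ c : Fin K → ℝ,
      circConv a (pad D a) + circConv b (pad D b) = circConv c (pad D c) := by
  obtain ⟨n, rfl⟩ : ∃ n, K = n + 1 := ⟨K - 1, by omega⟩
  obtain ⟨⟨x, y⟩, hxy, hmax⟩ :=
    (isCompact_setOf_circConv_pad_add (hK.trans hKD) hKD
      (circConv a (pad D a) + circConv b (pad D b))).exists_isMaxOn ⟨(a, b), rfl⟩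
      (f := fun p => p.1 0) (by fun_prop)
  have hy : y = 0 :=
    eq_zero_of_circConv_pad_add_maximal hKD (fun u v huv => hmax (a := (u, v)) huv) hxy
  subst hy
  refine ⟨x, ?_⟩
  have hzero : circConv (0 : Fin (n + 1) → ℝ) (pad D (0 : Fin (n + 1) → ℝ)) = 0 := by
    ext d
    simp [circConv]
  simpa [hzero] using hxy.symm
end
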